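/- arXiv:1101.2173 — 2 statements merged into one kernel-verified Lean document; each statement's English description precedes it below -/
import Mathlib

section
/- Real eigendecomposition, odd case: let k be odd and let A_0, …, A_{k−1} be n×n complex matrices satisfying the reality condition that A_0 has real entries and A_{k−j} = conj(A_j) (entrywise complex conjugation) for j = 1, …, k−1 — this is exactly the condition that the A_j are the Fourier slices of a real-valued n×n matrix over the circulant algebra K_k — and suppose each A_j is diagonalizable over ℂ. Then there exist eigendecompositions A_j = X_j · Λ_j · X_j^{−1} (X_j invertible, Λ_j diagonal) satisfying the same reality condition (X_0 and Λ_0 with real entries, X_{k−j} = conj(X_j) and Λ_{k−j} = conj(Λ_j) for all j) — equivalently, the circulant-algebra matrix admits a real-valued eigendecomposition X ∘ Λ ∘ X^{−1} — if and only if all eigenvalues of A_0 are real. -/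
open Matrix Polynomial


lemma charpoly_root_aux {n : ℕ} (B P : Matrix (Fin n) (Fin n) ℂ) (d : Fin n → ℂ)
    (hP : IsUnit P) (hB : B = P * Matrix.diagonal d * P⁻¹) (μ : ℂ) :
    B.charpoly.IsRoot μ ↔ ∃ i, μ = d i := by
  obtain ⟨U, rfl⟩ := hP
  have h : B.charpoly = (Matrix.diagonal d).charpoly := by
    rw [hB, Matrix.charpoly_units_conj]
  rw [h, Matrix.charpoly_diagonal, Polynomial.IsRoot.def, Polynomial.eval_prod,
    Finset.prod_eq_zero_iff]
  simp [sub_eq_zero]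

lemma real_slice_aux {n : ℕ} (B P : Matrix (Fin n) (Fin n) ℂ) (d : Fin n → ℂ)
    (hP : IsUnit P) (hB : B = P * Matrix.diagonal d * P⁻¹)
    (hBr : ∀ r s, (B r s).im = 0) (hd : ∀ i, (d i).im = 0) :
    ∃ Y : Matrix (Fin n) (Fin n) ℂ, IsUnit Y ∧ B = Y * Matrix.diagonal d * Y⁻¹ ∧
      ∀ r s, (Y r s).im = 0 := by
  have hPd : IsUnit P.det := (Matrix.isUnit_iff_isUnit_det P).1 hP
  have hBP : B * P = P * Matrix.diagonal d := by
    rw [hB, Matrix.mul_assoc, Matrix.nonsing_inv_mul P hPd, Matrix.mul_one]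
  let R : Matrix (Fin n) (Fin n) ℂ := P.map (fun z => (z.re : ℂ))
  let S : Matrix (Fin n) (Fin n) ℂ := P.map (fun z => (z.im : ℂ))
  have hR : B * R = R * Matrix.diagonal d := by
    ext r s
    have h := congrFun (congrFun hBP r) s
    rw [Matrix.mul_diagonal, Matrix.mul_apply] at h ⊢
    have h1 := congrArg Complex.re h
    simp only [Complex.re_sum, Complex.im_sum, Complex.mul_re, Complex.mul_im, hBr, hd,
      zero_mul, mul_zero, sub_zero, add_zero, zero_add] at h1
    apply Complex.ext
    · simpa [R, Complex.re_sum, hBr, hd] using h1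
    · simp [R, Complex.im_sum, hBr, hd]
  have hS : B * S = S * Matrix.diagonal d := by
    ext r s
    have h := congrFun (congrFun hBP r) s
    rw [Matrix.mul_diagonal, Matrix.mul_apply] at h ⊢
    have h1 := congrArg Complex.im h
    simp only [Complex.re_sum, Complex.im_sum, Complex.mul_re, Complex.mul_im, hBr, hd,
      zero_mul, mul_zero, sub_zero, add_zero, zero_add] at h1
    apply Complex.ext
    · simpa [S, Complex.re_sum, hBr, hd] using h1
    · simp [S, Complex.im_sum, hBr, hd]
  let M : Matrix (Fin n) (Fin n) ℂ[X] :=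
    Matrix.of fun r s => Polynomial.C (R r s) + Polynomial.X * Polynomial.C (S r s)
  have hM : ∀ t : ℂ, M.det.eval t = (R + t • S).det := by
    intro t
    rw [← Polynomial.coe_evalRingHom, RingHom.map_det]
    congr 1
    ext r s
    simp [M]
    exact mul_comm _ _
  have hne : M.det ≠ 0 := by
    intro h0
    have h := hM Complex.I
    rw [h0, Polynomial.eval_zero] at h
    have hRS : R + Complex.I • S = P := by
      ext r s
      simp only [R, S, Matrix.add_apply, Matrix.smul_apply, Matrix.map_apply, smul_eq_mul]
      rw [mul_comm, Complex.re_add_im]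
    rw [hRS] at h
    exact hPd.ne_zero h.symm
  obtain ⟨t, ht⟩ : ∃ t : ℝ, M.det.eval (t : ℂ) ≠ 0 := by
    by_contra! hall
    apply hne
    apply Polynomial.eq_zero_of_infinite_isRoot
    refine (Set.infinite_range_of_injective Complex.ofReal_injective).mono ?_
    rintro _ ⟨t, rfl⟩
    exact hall t
  rw [hM] at ht
  have hY := isUnit_iff_ne_zero.2 ht
  refine ⟨R + (t : ℂ) • S, (Matrix.isUnit_iff_isUnit_det _).2 hY, ?_, ?_⟩
  · have hBY : B * (R + (t : ℂ) • S) = (R + (t : ℂ) • S) * Matrix.diagonal d := by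
      rw [Matrix.mul_add, Matrix.add_mul, Matrix.mul_smul, Matrix.smul_mul, hR, hS]
    rw [← hBY, Matrix.mul_assoc, Matrix.mul_nonsing_inv _ hY, Matrix.mul_one]
  · intro r s
    simp [R, S]

lemma conj_decomp_aux {n : ℕ} (B P : Matrix (Fin n) (Fin n) ℂ) (d : Fin n → ℂ)
    (hP : IsUnit P) (hB : B = P * Matrix.diagonal d * P⁻¹) :
    IsUnit (P.map (starRingEnd ℂ)) ∧ B.map (starRingEnd ℂ) =
      P.map (starRingEnd ℂ) * Matrix.diagonal (fun i => starRingEnd ℂ (d i)) *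
        (P.map (starRingEnd ℂ))⁻¹ := by
  have hPd : IsUnit P.det := (Matrix.isUnit_iff_isUnit_det P).1 hP
  have h1 : IsUnit (P.map (starRingEnd ℂ)) := hP.map (starRingEnd ℂ).mapMatrix
  have hQ := (Matrix.isUnit_iff_isUnit_det _).1 h1
  have hBP : B * P = P * Matrix.diagonal d := by
    rw [hB, Matrix.mul_assoc, Matrix.nonsing_inv_mul P hPd, Matrix.mul_one]
  have h2 := congrArg (fun N : Matrix (Fin n) (Fin n) ℂ => N.map (starRingEnd ℂ)) hBP
  simp only [Matrix.map_mul] at h2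
  rw [Matrix.diagonal_map (map_zero _)] at h2
  refine ⟨h1, ?_⟩
  have h3 : (fun i => starRingEnd ℂ (d i)) = (starRingEnd ℂ) ∘ d := rfl
  first
  | rw [h3, ← h2, Matrix.mul_assoc, Matrix.mul_nonsing_inv _ hQ, Matrix.mul_one]
  | rw [← h2, Matrix.mul_assoc, Matrix.mul_nonsing_inv _ hQ, Matrix.mul_one]

lemma neg_lt_aux {k : ℕ} (hk : Odd k) [NeZero k] (j : Fin k) (hj : j ≠ 0) :
    (j < -j ∧ ¬ (-j < j)) ∨ (¬ (j < -j) ∧ -j < j) := by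
  have hne : j ≠ -j := by
    intro h
    have h1 := congrArg Fin.val h
    have h0 : j.val ≠ 0 := fun h => hj (Fin.ext (by simpa using h))
    rw [Fin.val_neg', Nat.mod_eq_of_lt (by omega)] at h1
    obtain ⟨m, hm⟩ := hk
    omega
  rcases lt_or_gt_of_ne hne with h | h
  · exact Or.inl ⟨h, h.asymm⟩
  · exact Or.inr ⟨h.asymm, h⟩

/-- Real eigendecomposition, odd case: let k be odd and let the slices A_j satisfy the
reality condition (A_0 real, A_{k−j} = conj(A_j)) and each be diagonalizable. Then there
are eigendecompositions A_j = X_j Λ_j X_j⁻¹ satisfying the same reality condition (i.e.,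
the circulant-algebra matrix has a real-valued eigendecomposition) if and only if all
eigenvalues of A_0 are real. -/
theorem real_eigendecomposition_odd (k n : ℕ) (hk : Odd k) [NeZero k]
    (A : Fin k → Matrix (Fin n) (Fin n) ℂ)
    (hreal0 : ∀ r s : Fin n, (A 0 r s).im = 0)
    (hconj : ∀ j : Fin k, j ≠ 0 → A (-j) = (A j).map (starRingEnd ℂ))
    (hdiag : ∀ j : Fin k, ∃ (P : Matrix (Fin n) (Fin n) ℂ) (d : Fin n → ℂ),
      IsUnit P ∧ A j = P * Matrix.diagonal d * P⁻¹) :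
    (∃ (X : Fin k → Matrix (Fin n) (Fin n) ℂ) (d : Fin k → Fin n → ℂ),
      (∀ j : Fin k, IsUnit (X j) ∧ A j = X j * Matrix.diagonal (d j) * (X j)⁻¹) ∧
      (∀ r s : Fin n, (X 0 r s).im = 0) ∧
      (∀ i : Fin n, (d 0 i).im = 0) ∧
      (∀ j : Fin k, j ≠ 0 →
        X (-j) = (X j).map (starRingEnd ℂ) ∧
        d (-j) = fun i => (starRingEnd ℂ) (d j i))) ↔
    (∀ μ : ℂ, ((A 0).charpoly).IsRoot μ → μ.im = 0) := by
  constructor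
  · rintro ⟨X, d, hX, -, hd, -⟩ μ hμ
    obtain ⟨i, rfl⟩ := (charpoly_root_aux (A 0) (X 0) (d 0) (hX 0).1 (hX 0).2 μ).1 hμ
    exact hd i
  · intro hroots
    choose P d hP hA using hdiag
    have hd0 : ∀ i, (d 0 i).im = 0 := fun i =>
      hroots _ ((charpoly_root_aux (A 0) (P 0) (d 0) (hP 0) (hA 0) _).2 ⟨i, rfl⟩)
    obtain ⟨Y, hYu, hYA, hYr⟩ := real_slice_aux (A 0) (P 0) (d 0) (hP 0) (hA 0) hreal0 hd0
    refine ⟨fun j => if j = 0 then Y else if j < -j then P j else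
        (P (-j)).map (starRingEnd ℂ),
      fun j => if j = 0 then d 0 else if j < -j then d j else
        fun i => starRingEnd ℂ (d (-j) i), ?_, ?_, ?_, ?_⟩
    · intro j
      by_cases hj : j = 0
      · subst hj
        simpa using ⟨hYu, hYA⟩
      · by_cases hlt : j < -j
        · simp only [if_neg hj, if_pos hlt]
          exact ⟨hP j, hA j⟩
        · simp only [if_neg hj, if_neg hlt]
          have h := conj_decomp_aux (A (-j)) (P (-j)) (d (-j)) (hP _) (hA _)
          rw [← hconj (-j) (neg_ne_zero.2 hj), neg_neg] at h
          exact h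
    · simpa using hYr
    · simpa using hd0
    · intro j hj
      have hj' : -j ≠ 0 := neg_ne_zero.2 hj
      rcases neg_lt_aux hk j hj with ⟨h1, h2⟩ | ⟨h1, h2⟩
      · simp only [if_neg hj, if_neg hj', neg_neg, if_pos h1, if_neg h2, and_self]
      · simp only [if_neg hj, if_neg hj', neg_neg, if_neg h1, if_pos h2]
        refine ⟨?_, ?_⟩
        · ext r s
          simp
        · funext i
          simp
end

section
/- Real eigendecomposition, even case: let k be even and let A_0, …, A_{k−1} be n×n complex matrices satisfying the reality condition that A_0 has real entries and A_{k−j} = conj(A_j) (entrywise complex conjugation) for j = 1, …, k−1 (so A_{k/2} is also real), and suppose each A_j is diagonalizable over ℂ. Then there exist eigendecompositions A_j = X_j · Λ_j · X_j^{−1} (X_j invertible, Λ_j diagonal) satisfying the same reality condition (X_0, Λ_0, X_{k/2}, Λ_{k/2} with real entries, and X_{k−j} = conj(X_j), Λ_{k−j} = conj(Λ_j) for all j) — equivalently, the circulant-algebra matrix admits a real-valued eigendecomposition — if and only if all eigenvalues of A_0 and all eigenvalues of A_{k/2} are real. -/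
open Matrix Polynomial

lemma aux_roots {n : ℕ} {B P : Matrix (Fin n) (Fin n) ℂ} {d : Fin n → ℂ} (hP : IsUnit P)
    (hB : B = P * Matrix.diagonal d * P⁻¹) (μ : ℂ) : B.charpoly.IsRoot μ ↔ ∃ i, d i = μ := by
  have h1 : B.charpoly = (Matrix.diagonal d).charpoly := by
    obtain ⟨u, rfl⟩ := hP
    rw [hB, Matrix.charpoly_units_conj]
  rw [h1, Matrix.charpoly_diagonal, Polynomial.IsRoot.def, Polynomial.eval_prod,
    Finset.prod_eq_zero_iff]
  simp [sub_eq_zero, eq_comm]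

lemma aux_real {n : ℕ} {B P : Matrix (Fin n) (Fin n) ℂ} {d : Fin n → ℂ} (hP : IsUnit P)
    (hB : B = P * Matrix.diagonal d * P⁻¹) (hr : ∀ r s, (B r s).im = 0)
    (hd : ∀ i, (d i).im = 0) :
    ∃ Q : Matrix (Fin n) (Fin n) ℂ, IsUnit Q ∧ B = Q * Matrix.diagonal d * Q⁻¹ ∧
      ∀ r s, (Q r s).im = 0 := by
  have hdet := (Matrix.isUnit_iff_isUnit_det P).1 hP
  have hBP : B * P = P * Matrix.diagonal d := by
    rw [hB, Matrix.mul_assoc, Matrix.nonsing_inv_mul _ hdet, Matrix.mul_one]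
  let U : Matrix (Fin n) (Fin n) ℂ := fun r s => ((P r s).re : ℂ)
  let V : Matrix (Fin n) (Fin n) ℂ := fun r s => ((P r s).im : ℂ)
  have hU : B * U = U * Matrix.diagonal d := by
    ext r s
    have h := congrFun (congrFun hBP r) s
    rw [Matrix.mul_diagonal, Matrix.mul_apply] at h ⊢
    have h' := congrArg Complex.re h
    apply Complex.ext
    · simpa [U, hr, hd] using h'
    · simp [U, hr, hd]
  have hV : B * V = V * Matrix.diagonal d := by
    ext r s
    have h := congrFun (congrFun hBP r) s
    rw [Matrix.mul_diagonal, Matrix.mul_apply] at h ⊢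
    have h' := congrArg Complex.im h
    apply Complex.ext
    · simpa [V, hr, hd] using h'
    · simp [V, hr, hd]
  let p : ℂ[X] := (U.map C + (X : ℂ[X]) • V.map C).det
  have hp : ∀ t : ℂ, p.eval t = (U + t • V).det := by
    intro t
    change (Polynomial.evalRingHom t) p = _
    rw [RingHom.map_det]
    congr 1
    ext r s
    simp
    exact mul_comm _ _
  have hPI : U + Complex.I • V = P := by
    ext r s
    change ((P r s).re : ℂ) + Complex.I * ((P r s).im : ℂ) = P r s
    rw [mul_comm, Complex.re_add_im]
  have hp0 : p ≠ 0 := by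
    intro h
    have := hp Complex.I
    rw [h, hPI, Polynomial.eval_zero] at this
    exact hdet.ne_zero this.symm
  obtain ⟨t, ht⟩ : ∃ t : ℝ, p.eval (t : ℂ) ≠ 0 := by
    by_contra! hcon
    apply hp0
    apply Polynomial.eq_zero_of_infinite_isRoot
    exact (Set.infinite_range_of_injective Complex.ofReal_injective).mono
      (by rintro _ ⟨t, rfl⟩; exact hcon t)
  rw [hp] at ht
  have hdetQ : IsUnit (U + (t : ℂ) • V).det := isUnit_iff_ne_zero.2 ht
  refine ⟨U + (t : ℂ) • V, (Matrix.isUnit_iff_isUnit_det _).2 hdetQ, ?_, ?_⟩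
  · have : (U + (t : ℂ) • V) * Matrix.diagonal d = B * (U + (t : ℂ) • V) := by
      rw [Matrix.add_mul, Matrix.mul_add, hU, Matrix.smul_mul, Matrix.mul_smul, hV]
    rw [this, Matrix.mul_assoc, Matrix.mul_nonsing_inv _ hdetQ, Matrix.mul_one]
  · intro r s
    change (((P r s).re : ℂ) + (t : ℂ) * ((P r s).im : ℂ)).im = 0
    simp

lemma aux_conj {n : ℕ} {B P : Matrix (Fin n) (Fin n) ℂ} {d : Fin n → ℂ} (hP : IsUnit P)
    (hB : B = P * Matrix.diagonal d * P⁻¹) :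
    IsUnit (P.map (starRingEnd ℂ)) ∧ B.map (starRingEnd ℂ) = P.map (starRingEnd ℂ) *
      Matrix.diagonal (fun i => (starRingEnd ℂ) (d i)) * (P.map (starRingEnd ℂ))⁻¹ := by
  have hdet := (Matrix.isUnit_iff_isUnit_det P).1 hP
  have hu : IsUnit (P.map (starRingEnd ℂ)) := hP.map (starRingEnd ℂ).mapMatrix
  have hdet' := (Matrix.isUnit_iff_isUnit_det _).1 hu
  refine ⟨hu, ?_⟩
  have hBP : B * P = P * Matrix.diagonal d := by
    rw [hB, Matrix.mul_assoc, Matrix.nonsing_inv_mul _ hdet, Matrix.mul_one]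
  have h := congrArg (fun M => M.map (starRingEnd ℂ)) hBP
  simp only [Matrix.map_mul] at h
  rw [Matrix.diagonal_map (map_zero _)] at h
  change _ = _ * Matrix.diagonal (fun i => (starRingEnd ℂ) (d i)) at h
  rw [← h, Matrix.mul_assoc, Matrix.mul_nonsing_inv _ hdet', Matrix.mul_one]

/-- Real eigendecomposition, even case: let k be even and positive, and let the slices
A_j satisfy the reality condition (A_0 real, A_{k−j} = conj(A_j), hence A_{k/2} real)
and each be diagonalizable. Then there are eigendecompositions A_j = X_j Λ_j X_j⁻¹
satisfying the same reality condition (i.e., the circulant-algebra matrix has a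
real-valued eigendecomposition) if and only if all eigenvalues of A_0 and all
eigenvalues of A_{k/2} are real. -/
theorem real_eigendecomposition_even (k n : ℕ) (hk : Even k) (hk0 : 0 < k) [NeZero k]
    (A : Fin k → Matrix (Fin n) (Fin n) ℂ)
    (hreal0 : ∀ r s : Fin n, (A 0 r s).im = 0)
    (hconj : ∀ j : Fin k, j ≠ 0 → A (-j) = (A j).map (starRingEnd ℂ))
    (hdiag : ∀ j : Fin k, ∃ (P : Matrix (Fin n) (Fin n) ℂ) (d : Fin n → ℂ),
      IsUnit P ∧ A j = P * Matrix.diagonal d * P⁻¹) :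
    (∃ (X : Fin k → Matrix (Fin n) (Fin n) ℂ) (d : Fin k → Fin n → ℂ),
      (∀ j : Fin k, IsUnit (X j) ∧ A j = X j * Matrix.diagonal (d j) * (X j)⁻¹) ∧
      (∀ r s : Fin n, (X 0 r s).im = 0) ∧
      (∀ i : Fin n, (d 0 i).im = 0) ∧
      (∀ r s : Fin n, (X (⟨k / 2, Nat.div_lt_self hk0 one_lt_two⟩ : Fin k) r s).im = 0) ∧
      (∀ i : Fin n, (d (⟨k / 2, Nat.div_lt_self hk0 one_lt_two⟩ : Fin k) i).im = 0) ∧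
      (∀ j : Fin k, j ≠ 0 →
        X (-j) = (X j).map (starRingEnd ℂ) ∧
        d (-j) = fun i => (starRingEnd ℂ) (d j i))) ↔
    ((∀ μ : ℂ, ((A 0).charpoly).IsRoot μ → μ.im = 0) ∧
     (∀ μ : ℂ, ((A (⟨k / 2, Nat.div_lt_self hk0 one_lt_two⟩ : Fin k)).charpoly).IsRoot μ →
        μ.im = 0)) := by
  set h : Fin k := ⟨k / 2, Nat.div_lt_self hk0 one_lt_two⟩ with hh
  have hneg : ∀ j : Fin k, j = -j → j = 0 ∨ j = h := by
    intro j hj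
    have h1 : j + j = 0 := by
      nth_rewrite 2 [hj]
      simp
    have h2 := congrArg Fin.val h1
    rw [Fin.val_add, Fin.val_zero] at h2
    have h3 := j.isLt
    obtain ⟨m, hm⟩ := Nat.dvd_of_mod_eq_zero h2
    have h4 : m < 2 := by
      by_contra hc
      have : k * 2 ≤ k * m := Nat.mul_le_mul_left _ (by omega)
      omega
    interval_cases m
    · left; apply Fin.ext; rw [Fin.val_zero]; omega
    · right; apply Fin.ext; rw [hh]; change j.val = k / 2; omega
  have hhneg : h = -h := by
    obtain ⟨m, hm⟩ := hk
    have : h + h = 0 := by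
      apply Fin.ext
      rw [Fin.val_add, Fin.val_zero, hh]
      change (k / 2 + k / 2) % k = 0
      have : k / 2 + k / 2 = k := by omega
      rw [this, Nat.mod_self]
    exact eq_neg_of_add_eq_zero_left this
  constructor
  · rintro ⟨X, d, hX, -, hd0, -, hdh, -⟩
    constructor
    · intro μ hμ
      obtain ⟨i, rfl⟩ := (aux_roots (hX 0).1 (hX 0).2 μ).1 hμ
      exact hd0 i
    · intro μ hμ
      obtain ⟨i, rfl⟩ := (aux_roots (hX h).1 (hX h).2 μ).1 hμ
      exact hdh i
  · rintro ⟨hr0, hrh⟩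
    have key : ∀ j : Fin k, ∃ (Q : Matrix (Fin n) (Fin n) ℂ) (e : Fin n → ℂ),
        (IsUnit Q ∧ A j = Q * Matrix.diagonal e * Q⁻¹) ∧
        (j = -j → (∀ r s, (Q r s).im = 0) ∧ ∀ i, (e i).im = 0) := by
      intro j
      obtain ⟨P, d, hP, hA⟩ := hdiag j
      by_cases hj : j = -j
      · have hAr : ∀ r s, (A j r s).im = 0 := by
          by_cases hj0 : j = 0
          · rw [hj0]; exact hreal0
          · intro r s
            have h1 := hconj j hj0
            rw [← hj] at h1
            have h2 := congrFun (congrFun h1 r) s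
            exact Complex.conj_eq_iff_im.1 h2.symm
        have hdr : ∀ i, (d i).im = 0 := by
          intro i
          have h1 := (aux_roots hP hA (d i)).2 ⟨i, rfl⟩
          rcases hneg j hj with h2 | h2
          · rw [h2] at h1; exact hr0 _ h1
          · rw [h2] at h1; exact hrh _ h1
        obtain ⟨Q, hQ, hAQ, hQr⟩ := aux_real hP hA hAr hdr
        exact ⟨Q, d, ⟨hQ, hAQ⟩, fun _ => ⟨hQr, hdr⟩⟩
      · exact ⟨P, d, ⟨hP, hA⟩, fun h => absurd h hj⟩
    choose Q e hQ hQr using key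
    refine ⟨fun j => if j ≤ -j then Q j else (Q (-j)).map (starRingEnd ℂ),
      fun j => if j ≤ -j then e j else fun i => (starRingEnd ℂ) (e (-j) i), ?_, ?_, ?_, ?_, ?_, ?_⟩
    · intro j
      by_cases hj : j ≤ -j
      · simp only [if_pos hj]; exact hQ j
      · simp only [if_neg hj]
        have hj0 : -j ≠ 0 := by
          intro h0
          apply hj
          rw [neg_eq_zero.1 h0]; simp
        have h1 := hconj (-j) hj0
        rw [neg_neg] at h1
        rw [h1]
        exact aux_conj (hQ (-j)).1 (hQ (-j)).2
    · have h0 : (0 : Fin k) = -0 := by simp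
      simp only [if_pos h0.le]
      exact (hQr 0 h0).1
    · have h0 : (0 : Fin k) = -0 := by simp
      simp only [if_pos h0.le]
      exact (hQr 0 h0).2
    · simp only [if_pos hhneg.le]
      exact (hQr h hhneg).1
    · simp only [if_pos hhneg.le]
      exact (hQr h hhneg).2
    · intro j _
      simp only [neg_neg]
      rcases lt_trichotomy j (-j) with hj | hj | hj
      · simp only [if_neg (not_le.2 hj), if_pos hj.le, and_self]
      · simp only [← hj, le_refl, if_true]
        constructor
        · ext r s
          exact (Complex.conj_eq_iff_im.2 ((hQr j hj).1 r s)).symm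
        · ext i
          exact (Complex.conj_eq_iff_im.2 ((hQr j hj).2 i)).symm
      · simp only [if_neg (not_le.2 hj), if_pos hj.le]
        constructor
        · ext r s
          simp
        · ext i
          simp
end
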